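/- arXiv:1712.06805 — 3 statements merged into one kernel-verified Lean document; each statement's English description precedes it below -/
import Mathlib

section
/- Let 𝒜 and 𝒝 be nonempty compact ℋ-sets of entrywise positive matrices of dimensions N×M and M×N respectively, and suppose à ∈ 𝒜 and B̃ ∈ 𝒝 form a saddle point, i.e. ρ(AB̃) ≤ ρ(ÃB̃) ≤ ρ(ÃB) for all A ∈ 𝒜 and B ∈ 𝒝. Then for every n ≥ 1: max_{A_1,…,A_n ∈ 𝒜} min_{B_1,…,B_n ∈ 𝒝} ρ(A_n B_n ⋯ A_1 B_1) = min_{B_1,…,B_n ∈ 𝒝} max_{A_1,…,A_n ∈ 𝒜} ρ(A_n B_n ⋯ A_1 B_1) = ρ(ÃB̃)^n. -/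
open Filter

/-- The product `A_n B_n ⋯ A_1 B_1` for collections of matrices indexed by `Fin n`. -/
def prodABFin {N M n : ℕ} (A : Fin n → Matrix (Fin N) (Fin M) ℝ)
    (B : Fin n → Matrix (Fin M) (Fin N) ℝ) : Matrix (Fin N) (Fin N) ℝ :=
  (List.ofFn fun i => A i * B i).reverse.prod

/-- The spectral radius of a real square matrix: the maximum of the absolute
values (norms) of its complex eigenvalues. -/
noncomputable def specRad {N : ℕ} (C : Matrix (Fin N) (Fin N) ℝ) : ℝ :=
  (spectralRadius ℂ (C.map fun x : ℝ => (x : ℂ))).toReal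

/-- A set `𝒜` of (entrywise positive) real `N×M` matrices is an ℋ-set
(hourglass set) if for every `Ã ∈ 𝒜` and every entrywise positive
vector `u`: (a) either `A u ≥ Ã u` entrywise for all `A ∈ 𝒜`, or there exists
`Ā ∈ 𝒜` with `Ā u ≤ Ã u` entrywise and `Ā u ≠ Ã u`; and (b) either
`A u ≤ Ã u` entrywise for all `A ∈ 𝒜`, or there exists `Ā ∈ 𝒜` with
`Ā u ≥ Ã u` entrywise and `Ā u ≠ Ã u`. -/
def IsHSet {N M : ℕ} (𝒜 : Set (Matrix (Fin N) (Fin M) ℝ)) : Prop :=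
  ∀ Atil ∈ 𝒜, ∀ u : Fin M → ℝ, (∀ j, 0 < u j) →
    ((∀ A ∈ 𝒜, ∀ i, Atil.mulVec u i ≤ A.mulVec u i) ∨
        ∃ Abar ∈ 𝒜, (∀ i, Abar.mulVec u i ≤ Atil.mulVec u i) ∧
          Abar.mulVec u ≠ Atil.mulVec u) ∧
      ((∀ A ∈ 𝒜, ∀ i, A.mulVec u i ≤ Atil.mulVec u i) ∨
        ∃ Abar ∈ 𝒜, (∀ i, Atil.mulVec u i ≤ Abar.mulVec u i) ∧
          Abar.mulVec u ≠ Atil.mulVec u)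

section ComplexEigenvector

attribute [local instance] Matrix.linftyOpNormedRing Matrix.linftyOpNormedAlgebra

theorem specRad_nonneg {N : ℕ} (C : Matrix (Fin N) (Fin N) ℝ) : 0 ≤ specRad C :=
  ENNReal.toReal_nonneg

theorem specRad_zero {N : ℕ} : specRad (0 : Matrix (Fin N) (Fin N) ℝ) = 0 := by
  have h : (0 : Matrix (Fin N) (Fin N) ℝ).map (fun x : ℝ => (x : ℂ)) = 0 := by
    ext i j; simp
  rw [specRad, h, spectrum.spectralRadius_zero, ENNReal.toReal_zero]

/-- The spectral radius is the absolute value of some complex eigenvalue. -/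
theorem exists_eigenvector_norm_eq_specRad {N : ℕ} [NeZero N] (C : Matrix (Fin N) (Fin N) ℝ) :
    ∃ (μ : ℂ) (x : Fin N → ℂ), x ≠ 0 ∧ (C.map fun t : ℝ => (t : ℂ)).mulVec x = μ • x ∧
      ‖μ‖ = specRad C := by
  obtain ⟨μ, hμ, h⟩ := spectrum.exists_nnnorm_eq_spectralRadius (C.map fun t : ℝ => (t : ℂ))
  rw [← Matrix.spectrum_toLin', ← Module.End.hasEigenvalue_iff_mem_spectrum] at hμ
  obtain ⟨x, hx⟩ := hμ.exists_hasEigenvector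
  refine ⟨μ, x, hx.2, by simpa using hx.apply_eq_smul, ?_⟩
  rw [specRad, ← h]
  simp

/-- A real matrix applied to a real vector, seen over `ℂ`. -/
theorem map_ofReal_mulVec {N M : ℕ} (C : Matrix (Fin N) (Fin M) ℝ) (v : Fin M → ℝ) :
    (C.map fun t : ℝ => (t : ℂ)).mulVec (fun j => (v j : ℂ)) = fun i => (C.mulVec v i : ℂ) := by
  ext i
  simp [Matrix.mulVec, dotProduct]

theorem map_ofReal_pow {N : ℕ} (C : Matrix (Fin N) (Fin N) ℝ) (k : ℕ) :
    (C.map fun t : ℝ => (t : ℂ)) ^ k = (C ^ k).map fun t : ℝ => (t : ℂ) :=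
  (map_pow (Complex.ofRealHom.mapMatrix (m := Fin N)) C k).symm

/-- If `C ^ k v ≥ c ^ k v` for all `k`, then `c` is at most the spectral radius of `C`. -/
theorem le_specRad_of_pow {N : ℕ} [NeZero N] {C : Matrix (Fin N) (Fin N) ℝ} {v : Fin N → ℝ}
    {c : ℝ} (hc : 0 ≤ c) (hv : ∀ i, 0 < v i) (h : ∀ k i, c ^ k * v i ≤ (C ^ k).mulVec v i) :
    c ≤ specRad C := by
  set D := C.map fun t : ℝ => (t : ℂ) with hD
  set w : Fin N → ℂ := fun j => (v j : ℂ) with hw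
  have hwpos : 0 < ‖w‖ := by
    rw [norm_pos_iff]
    intro h0
    have := congrFun h0 0
    simp [hw, (hv 0).ne'] at this
  have hpow (k : ℕ) : c ^ k ≤ ‖D ^ k‖ := by
    refine le_of_mul_le_mul_right ?_ hwpos
    refine le_trans ?_ (Matrix.linfty_opNorm_mulVec (D ^ k) w)
    have hsmul : c ^ k * ‖w‖ = ‖(c ^ k) • w‖ := by
      rw [norm_smul, Real.norm_of_nonneg (pow_nonneg hc k)]
    rw [hsmul, pi_norm_le_iff_of_nonneg (norm_nonneg _)]
    intro i
    refine le_trans ?_ (norm_le_pi_norm _ i)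
    rw [hD, map_ofReal_pow, map_ofReal_mulVec]
    have h0 : 0 ≤ c ^ k * v i := mul_nonneg (pow_nonneg hc k) (hv i).le
    have : ((c ^ k) • w) i = ((c ^ k * v i : ℝ) : ℂ) := by simp [hw]
    rw [this, Complex.norm_of_nonneg h0, Complex.norm_of_nonneg (h0.trans (h k i))]
    exact h k i
  have hlim := spectrum.pow_nnnorm_pow_one_div_tendsto_nhds_spectralRadius D
  have hle : ENNReal.ofReal c ≤ spectralRadius ℂ D := by
    refine ge_of_tendsto hlim ?_
    filter_upwards [Filter.eventually_ge_atTop 1] with k hk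
    rw [one_div, ENNReal.le_rpow_inv_iff (by positivity), ENNReal.rpow_natCast,
      ← ENNReal.ofReal_pow hc]
    exact ENNReal.ofReal_le_of_le_toReal (by simpa using hpow k)
  have hfin : spectralRadius ℂ D ≠ ⊤ :=
    ne_top_of_le_ne_top ENNReal.coe_ne_top (spectrum.spectralRadius_le_nnnorm D)
  exact (ENNReal.ofReal_le_iff_le_toReal hfin).1 hle

end ComplexEigenvector

theorem mulVec_mono_of_nonneg {N M : ℕ} {C : Matrix (Fin N) (Fin M) ℝ} (hC : ∀ i j, 0 ≤ C i j)
    {x y : Fin M → ℝ} (hxy : ∀ j, x j ≤ y j) (i : Fin N) : C.mulVec x i ≤ C.mulVec y i := by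
  simp only [Matrix.mulVec, dotProduct]
  exact Finset.sum_le_sum fun j _ => mul_le_mul_of_nonneg_left (hxy j) (hC i j)

theorem mulVec_strictMono_of_pos {N M : ℕ} {C : Matrix (Fin N) (Fin M) ℝ}
    (hC : ∀ i j, 0 < C i j) {x y : Fin M → ℝ} (hxy : ∀ j, x j ≤ y j) (hne : x ≠ y)
    (i : Fin N) : C.mulVec x i < C.mulVec y i := by
  obtain ⟨j, hj⟩ := Function.ne_iff.1 hne
  exact Finset.sum_lt_sum (fun j _ => mul_le_mul_of_nonneg_left (hxy j) (hC i j).le)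
    ⟨j, Finset.mem_univ j, mul_lt_mul_of_pos_left (lt_of_le_of_ne (hxy j) hj) (hC i j)⟩

theorem mulVec_pos_of_pos {N M : ℕ} [NeZero M] {C : Matrix (Fin N) (Fin M) ℝ}
    (hC : ∀ i j, 0 < C i j) {x : Fin M → ℝ} (hx : ∀ j, 0 < x j) (i : Fin N) :
    0 < C.mulVec x i :=
  Finset.sum_pos (fun j _ => mul_pos (hC i j) (hx j)) Finset.univ_nonempty

theorem mul_entry_pos {N M K : ℕ} [NeZero M] {A : Matrix (Fin N) (Fin M) ℝ}
    {B : Matrix (Fin M) (Fin K) ℝ} (hA : ∀ i j, 0 < A i j) (hB : ∀ i j, 0 < B i j)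
    (i : Fin N) (j : Fin K) : 0 < (A * B) i j :=
  Finset.sum_pos (fun k _ => mul_pos (hA i k) (hB k j)) Finset.univ_nonempty

theorem norm_mulVec_le {N : ℕ} {C : Matrix (Fin N) (Fin N) ℝ} (hC : ∀ i j, 0 ≤ C i j)
    (x : Fin N → ℂ) (i : Fin N) :
    ‖(C.map fun t : ℝ => (t : ℂ)).mulVec x i‖ ≤ C.mulVec (fun j => ‖x j‖) i := by
  simp only [Matrix.mulVec, dotProduct]
  refine (norm_sum_le _ _).trans (Finset.sum_le_sum fun j _ => ?_)
  simp [abs_of_nonneg (hC i j)]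

/-- Collatz–Wielandt upper bound. -/
theorem specRad_le_of_mulVec_le {N : ℕ} [NeZero N] {C : Matrix (Fin N) (Fin N) ℝ}
    (hC : ∀ i j, 0 ≤ C i j) {v : Fin N → ℝ} (hv : ∀ i, 0 < v i) {c : ℝ}
    (h : ∀ i, C.mulVec v i ≤ c * v i) : specRad C ≤ c := by
  obtain ⟨μ, x, hx, hCx, hμ⟩ := exists_eigenvector_norm_eq_specRad C
  obtain ⟨k, hk⟩ := Finite.exists_max fun i => ‖x i‖ / v i
  set t := ‖x k‖ / v k with ht
  have hxt (i : Fin N) : ‖x i‖ ≤ t * v i := (div_le_iff₀ (hv i)).1 (hk i)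
  have htpos : 0 < t := by
    obtain ⟨i, hi⟩ := Function.ne_iff.1 hx
    exact lt_of_lt_of_le (div_pos (norm_pos_iff.2 hi) (hv i)) (hk i)
  have hxk : ‖x k‖ = t * v k := by rw [ht, div_mul_cancel₀ _ (hv k).ne']
  have key : specRad C * (t * v k) ≤ c * (t * v k) := by
    calc specRad C * (t * v k) = ‖(C.map fun s : ℝ => (s : ℂ)).mulVec x k‖ := by
          rw [hCx, Pi.smul_apply, norm_smul, hμ, hxk]
      _ ≤ C.mulVec (fun j => ‖x j‖) k := norm_mulVec_le hC x k
      _ ≤ C.mulVec (t • v) k := mulVec_mono_of_nonneg hC hxt k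
      _ = t * C.mulVec v k := by rw [Matrix.mulVec_smul, Pi.smul_apply, smul_eq_mul]
      _ ≤ t * (c * v k) := mul_le_mul_of_nonneg_left (h k) htpos.le
      _ = c * (t * v k) := by ring
  exact le_of_mul_le_mul_right key (mul_pos htpos (hv k))

theorem list_prod_nonneg {N : ℕ} (l : List (Matrix (Fin N) (Fin N) ℝ))
    (h : ∀ D ∈ l, ∀ i j, 0 ≤ D i j) (i j : Fin N) : 0 ≤ l.prod i j := by
  induction l generalizing i j with
  | nil => rw [List.prod_nil, Matrix.one_apply]; split_ifs <;> norm_num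
  | cons D l ih =>
    rw [List.prod_cons, Matrix.mul_apply]
    exact Finset.sum_nonneg fun k _ => mul_nonneg (h D (by simp) i k)
      (ih (fun E hE => h E (by simp [hE])) k j)

theorem pow_mul_le_list_prod_mulVec {N : ℕ} {v : Fin N → ℝ} {c : ℝ} (hc : 0 ≤ c)
    (l : List (Matrix (Fin N) (Fin N) ℝ)) (hl : ∀ D ∈ l, ∀ i j, 0 ≤ D i j)
    (h : ∀ D ∈ l, ∀ i, c * v i ≤ D.mulVec v i) (i : Fin N) :
    c ^ l.length * v i ≤ l.prod.mulVec v i := by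
  induction l generalizing i with
  | nil => simp
  | cons D l ih =>
    have ih' := ih (fun E hE => hl E (by simp [hE])) (fun E hE => h E (by simp [hE]))
    calc c ^ (D :: l).length * v i = c ^ l.length * (c * v i) := by
          rw [List.length_cons]; ring
      _ ≤ c ^ l.length * D.mulVec v i :=
          mul_le_mul_of_nonneg_left (h D (by simp) i) (pow_nonneg hc _)
      _ = D.mulVec (c ^ l.length • v) i := by
          rw [Matrix.mulVec_smul, Pi.smul_apply, smul_eq_mul]
      _ ≤ D.mulVec (l.prod.mulVec v) i := mulVec_mono_of_nonneg (hl D (by simp)) ih' i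
      _ = (D :: l).prod.mulVec v i := by rw [Matrix.mulVec_mulVec, List.prod_cons]

theorem list_prod_mulVec_le_pow_mul {N : ℕ} {v : Fin N → ℝ} {c : ℝ} (hc : 0 ≤ c)
    (l : List (Matrix (Fin N) (Fin N) ℝ)) (hl : ∀ D ∈ l, ∀ i j, 0 ≤ D i j)
    (h : ∀ D ∈ l, ∀ i, D.mulVec v i ≤ c * v i) (i : Fin N) :
    l.prod.mulVec v i ≤ c ^ l.length * v i := by
  induction l generalizing i with
  | nil => simp
  | cons D l ih =>
    have ih' := ih (fun E hE => hl E (by simp [hE])) (fun E hE => h E (by simp [hE]))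
    calc (D :: l).prod.mulVec v i = D.mulVec (l.prod.mulVec v) i := by
          rw [Matrix.mulVec_mulVec, List.prod_cons]
      _ ≤ D.mulVec (c ^ l.length • v) i := mulVec_mono_of_nonneg (hl D (by simp)) ih' i
      _ = c ^ l.length * D.mulVec v i := by
          rw [Matrix.mulVec_smul, Pi.smul_apply, smul_eq_mul]
      _ ≤ c ^ l.length * (c * v i) :=
          mul_le_mul_of_nonneg_left (h D (by simp) i) (pow_nonneg hc _)
      _ = c ^ (D :: l).length * v i := by rw [List.length_cons]; ring

/-- Collatz–Wielandt lower bound. -/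
theorem le_specRad_of_le_mulVec {N : ℕ} [NeZero N] {C : Matrix (Fin N) (Fin N) ℝ}
    (hC : ∀ i j, 0 ≤ C i j) {v : Fin N → ℝ} (hv : ∀ i, 0 < v i) {c : ℝ} (hc : 0 ≤ c)
    (h : ∀ i, c * v i ≤ C.mulVec v i) : c ≤ specRad C := by
  refine le_specRad_of_pow hc hv fun k i => ?_
  have hmem : ∀ D ∈ List.replicate k C, D = C := fun D => List.eq_of_mem_replicate
  simpa using pow_mul_le_list_prod_mulVec hc (List.replicate k C)
    (fun D hD => hmem D hD ▸ hC) (fun D hD => hmem D hD ▸ h) i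

theorem specRad_lt_of_mulVec_lt {N : ℕ} [NeZero N] {C : Matrix (Fin N) (Fin N) ℝ}
    (hC : ∀ i j, 0 ≤ C i j) {v : Fin N → ℝ} (hv : ∀ i, 0 < v i) {c : ℝ}
    (h : ∀ i, C.mulVec v i < c * v i) : specRad C < c := by
  obtain ⟨k, hk⟩ := Finite.exists_max fun i => C.mulVec v i / v i
  exact (specRad_le_of_mulVec_le hC hv fun i => (div_le_iff₀ (hv i)).1 (hk i)).trans_lt
    ((div_lt_iff₀ (hv k)).2 (h k))

theorem lt_specRad_of_lt_mulVec {N : ℕ} [NeZero N] {C : Matrix (Fin N) (Fin N) ℝ}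
    (hC : ∀ i j, 0 ≤ C i j) {v : Fin N → ℝ} (hv : ∀ i, 0 < v i) {c : ℝ} (hc : 0 ≤ c)
    (h : ∀ i, c * v i < C.mulVec v i) : c < specRad C := by
  obtain ⟨k, hk⟩ := Finite.exists_min fun i => C.mulVec v i / v i
  have hlt : c < C.mulVec v k / v k := (lt_div_iff₀ (hv k)).2 (h k)
  exact hlt.trans_le (le_specRad_of_le_mulVec hC hv (hc.trans hlt.le)
    fun i => (le_div_iff₀ (hv i)).1 (hk i))

/-- If `C` is positive and `0 ≤ v`, `c v ≤ C v`, `c v ≠ C v`, then `c < ρ(C)`. -/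
theorem lt_specRad_of_le_mulVec_of_ne {N : ℕ} [NeZero N] {C : Matrix (Fin N) (Fin N) ℝ}
    (hC : ∀ i j, 0 < C i j) {v : Fin N → ℝ} (hv : ∀ i, 0 ≤ v i) {c : ℝ} (hc : 0 ≤ c)
    (h : ∀ i, c * v i ≤ C.mulVec v i) (hne : c • v ≠ C.mulVec v) : c < specRad C := by
  have hv0 : (0 : Fin N → ℝ) ≠ v := by
    rintro rfl
    simp at hne
  have hpos (i : Fin N) : 0 < C.mulVec v i := by
    simpa using mulVec_strictMono_of_pos hC (x := 0) hv hv0 i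
  refine lt_specRad_of_lt_mulVec (fun i j => (hC i j).le) hpos hc fun i => ?_
  simpa [Matrix.mulVec_smul] using mulVec_strictMono_of_pos hC (x := c • v) h hne i

/-- **Perron's theorem**: the spectral radius of a positive matrix is an eigenvalue with a positive
eigenvector. -/
theorem exists_pos_eigenvector {N : ℕ} [NeZero N] {C : Matrix (Fin N) (Fin N) ℝ}
    (hC : ∀ i j, 0 < C i j) :
    ∃ v : Fin N → ℝ, (∀ i, 0 < v i) ∧ C.mulVec v = specRad C • v := by
  obtain ⟨μ, x, hx, hCx, hμ⟩ := exists_eigenvector_norm_eq_specRad C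
  set y : Fin N → ℝ := fun i => ‖x i‖ with hy
  have hy0 (i : Fin N) : 0 ≤ y i := norm_nonneg _
  have hyne : (0 : Fin N → ℝ) ≠ y := by
    obtain ⟨i, hi⟩ := Function.ne_iff.1 hx
    exact fun h => hi (norm_eq_zero.1 (congrFun h i).symm)
  have hle (i : Fin N) : specRad C * y i ≤ C.mulVec y i := by
    refine le_trans (le_of_eq ?_) (norm_mulVec_le (fun i j => (hC i j).le) x i)
    rw [hCx, Pi.smul_apply, norm_smul, hμ]
  have heq : specRad C • y = C.mulVec y := by
    by_contra hne
    exact lt_irrefl _ (lt_specRad_of_le_mulVec_of_ne hC hy0 (specRad_nonneg C) hle hne)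
  refine ⟨y, fun i => ?_, heq.symm⟩
  have hpos : 0 < C.mulVec y i := by
    simpa using mulVec_strictMono_of_pos hC (x := 0) hy0 hyne i
  rw [← heq, Pi.smul_apply, smul_eq_mul] at hpos
  exact pos_of_mul_pos_right hpos (specRad_nonneg C)

theorem exists_entry_bound {N M : ℕ} {𝒜 : Set (Matrix (Fin N) (Fin M) ℝ)} (h : IsCompact 𝒜) :
    ∃ K : ℝ, 0 ≤ K ∧ ∀ A ∈ 𝒜, ∀ i j, A i j ≤ K := by
  have hb (p : Fin N × Fin M) : ∃ K : ℝ, ∀ A ∈ 𝒜, A p.1 p.2 ≤ K := by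
    obtain ⟨K, hK⟩ := h.bddAbove_image (f := fun A : Matrix (Fin N) (Fin M) ℝ => A p.1 p.2)
      (by fun_prop)
    exact ⟨K, fun A hA => hK (Set.mem_image_of_mem _ hA)⟩
  choose K hK using hb
  refine ⟨∑ p, |K p|, Finset.sum_nonneg fun p _ => abs_nonneg _, fun A hA i j => ?_⟩
  exact ((hK (i, j) A hA).trans (le_abs_self _)).trans
    (Finset.single_le_sum (f := fun p => |K p|) (fun p _ => abs_nonneg _) (Finset.mem_univ (i, j)))

theorem le_specRad_prodABFin {N M n : ℕ} [NeZero N] {A : Fin n → Matrix (Fin N) (Fin M) ℝ}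
    {B : Fin n → Matrix (Fin M) (Fin N) ℝ} (hAB : ∀ k i j, 0 ≤ (A k * B k) i j)
    {v : Fin N → ℝ} (hv : ∀ i, 0 < v i) {c : ℝ} (hc : 0 ≤ c)
    (h : ∀ k i, c * v i ≤ (A k * B k).mulVec v i) : c ^ n ≤ specRad (prodABFin A B) := by
  have hl : ∀ D ∈ (List.ofFn fun i => A i * B i).reverse, ∃ k, A k * B k = D := by
    simp [List.mem_ofFn]
  have hl0 : ∀ D ∈ (List.ofFn fun i => A i * B i).reverse, ∀ i j, 0 ≤ D i j := by
    intro D hD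
    obtain ⟨k, rfl⟩ := hl D hD
    exact hAB k
  refine le_specRad_of_le_mulVec (list_prod_nonneg _ hl0) hv (pow_nonneg hc n) fun i => ?_
  simpa using pow_mul_le_list_prod_mulVec hc _ hl0
    (fun D hD => by obtain ⟨k, rfl⟩ := hl D hD; exact h k) i

theorem specRad_prodABFin_le {N M n : ℕ} [NeZero N] {A : Fin n → Matrix (Fin N) (Fin M) ℝ}
    {B : Fin n → Matrix (Fin M) (Fin N) ℝ} (hAB : ∀ k i j, 0 ≤ (A k * B k) i j)
    {v : Fin N → ℝ} (hv : ∀ i, 0 < v i) {c : ℝ} (hc : 0 ≤ c)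
    (h : ∀ k i, (A k * B k).mulVec v i ≤ c * v i) : specRad (prodABFin A B) ≤ c ^ n := by
  have hl : ∀ D ∈ (List.ofFn fun i => A i * B i).reverse, ∃ k, A k * B k = D := by
    simp [List.mem_ofFn]
  have hl0 : ∀ D ∈ (List.ofFn fun i => A i * B i).reverse, ∀ i j, 0 ≤ D i j := by
    intro D hD
    obtain ⟨k, rfl⟩ := hl D hD
    exact hAB k
  refine specRad_le_of_mulVec_le (list_prod_nonneg _ hl0) hv fun i => ?_
  simpa using list_prod_mulVec_le_pow_mul hc _ hl0
    (fun D hD => by obtain ⟨k, rfl⟩ := hl D hD; exact h k) i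

/-- A saddle point of a nonnegative real function determines its `sup inf` and `inf sup`. -/
theorem iSup_iInf_eq_of_saddle {α β : Type*} {f : α → β → ℝ} {c : ℝ} (h0 : ∀ a b, 0 ≤ f a b)
    (hbdd : ∀ b, BddAbove (Set.range fun a => f a b)) (a₀ : α) (b₀ : β)
    (ha : ∀ b, c ≤ f a₀ b) (hb : ∀ a, f a b₀ ≤ c) :
    (⨆ a, ⨅ b, f a b) = c ∧ (⨅ b, ⨆ a, f a b) = c := by
  have : Nonempty α := ⟨a₀⟩
  have : Nonempty β := ⟨b₀⟩
  have hinf (a : α) : (⨅ b, f a b) ≤ c :=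
    (ciInf_le ⟨0, Set.forall_mem_range.2 (h0 a)⟩ b₀).trans (hb a)
  have hsup (b : β) : c ≤ ⨆ a, f a b := (ha b).trans (le_ciSup (hbdd b) a₀)
  refine ⟨le_antisymm (ciSup_le hinf) ?_, le_antisymm ?_ (le_ciInf hsup)⟩
  · exact (le_ciInf ha).trans (le_ciSup (f := fun a => ⨅ b, f a b)
      ⟨c, Set.forall_mem_range.2 hinf⟩ a₀)
  · exact (ciInf_le (f := fun b => ⨆ a, f a b) ⟨c, Set.forall_mem_range.2 hsup⟩ b₀).trans
      (ciSup_le hb)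

theorem specRad_eq_zero_of_dim_eq_zero {N M : ℕ} (h : N = 0 ∨ M = 0)
    (A : Matrix (Fin N) (Fin M) ℝ) (B : Matrix (Fin M) (Fin N) ℝ)
    (C : Matrix (Fin N) (Fin N) ℝ) : specRad (C * (A * B)) = 0 := by
  have : C * (A * B) = 0 := by
    rcases h with rfl | rfl
    · exact Subsingleton.elim _ _
    · rw [Subsingleton.elim A 0, Matrix.zero_mul, mul_zero]
  rw [this, specRad_zero]

/-- Let `𝒜`, `𝒝` be nonempty compact ℋ-sets of entrywise
positive matrices of dimensions `N×M` and `M×N`, and let `Ã ∈ 𝒜`, `B̃ ∈ 𝒝` form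
a saddle point: `ρ(A B̃) ≤ ρ(Ã B̃) ≤ ρ(Ã B)` for all `A ∈ 𝒜`, `B ∈ 𝒝`.  Then for
every `n ≥ 1`,
`max_{A_i ∈ 𝒜} min_{B_i ∈ 𝒝} ρ(A_n B_n ⋯ A_1 B_1)
  = min_{B_i ∈ 𝒝} max_{A_i ∈ 𝒜} ρ(A_n B_n ⋯ A_1 B_1) = ρ(Ã B̃)^n`
(maxima and minima over the compact sets are attained, and are expressed as
suprema and infima). -/
theorem hset_saddle_minimax {N M : ℕ}
    (𝒜 : Set (Matrix (Fin N) (Fin M) ℝ)) (𝒝 : Set (Matrix (Fin M) (Fin N) ℝ))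
    (hAne : 𝒜.Nonempty) (hBne : 𝒝.Nonempty)
    (hAcomp : IsCompact 𝒜) (hBcomp : IsCompact 𝒝)
    (hApos : ∀ A ∈ 𝒜, ∀ i j, 0 < A i j)
    (hBpos : ∀ B ∈ 𝒝, ∀ i j, 0 < B i j)
    (hAH : IsHSet 𝒜) (hBH : IsHSet 𝒝)
    (Atil : Matrix (Fin N) (Fin M) ℝ) (Btil : Matrix (Fin M) (Fin N) ℝ)
    (hAtil : Atil ∈ 𝒜) (hBtil : Btil ∈ 𝒝)
    (hsaddle : ∀ A ∈ 𝒜, ∀ B ∈ 𝒝,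
      specRad (A * Btil) ≤ specRad (Atil * Btil) ∧
        specRad (Atil * Btil) ≤ specRad (Atil * B))
    (n : ℕ) (hn : 1 ≤ n) :
    (⨆ A : Fin n → 𝒜, ⨅ B : Fin n → 𝒝,
        specRad (prodABFin (fun i => (A i : Matrix (Fin N) (Fin M) ℝ))
          fun i => (B i : Matrix (Fin M) (Fin N) ℝ))) =
        specRad (Atil * Btil) ^ n ∧
      (⨅ B : Fin n → 𝒝, ⨆ A : Fin n → 𝒜,
          specRad (prodABFin (fun i => (A i : Matrix (Fin N) (Fin M) ℝ))
            fun i => (B i : Matrix (Fin M) (Fin N) ℝ))) =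
        specRad (Atil * Btil) ^ n := by
  have hA0 : ∀ A ∈ 𝒜, ∀ i j, 0 ≤ A i j := fun A hA i j => (hApos A hA i j).le
  have hB0 : ∀ B ∈ 𝒝, ∀ i j, 0 ≤ B i j := fun B hB i j => (hBpos B hB i j).le
  by_cases hdim : N = 0 ∨ M = 0
  · have hr : specRad (Atil * Btil) ^ n = 0 := by
      have := specRad_eq_zero_of_dim_eq_zero hdim Atil Btil 1
      rw [one_mul] at this
      rw [this, zero_pow (by omega)]
    have hf (A : Fin n → 𝒜) (B : Fin n → 𝒝) :
        specRad (prodABFin (fun i => (A i : Matrix (Fin N) (Fin M) ℝ))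
          fun i => (B i : Matrix (Fin M) (Fin N) ℝ)) = 0 := by
      obtain ⟨m, rfl⟩ : ∃ m, n = m + 1 := ⟨n - 1, by omega⟩
      rw [prodABFin, List.ofFn_succ, List.reverse_cons, List.prod_append, List.prod_singleton]
      exact specRad_eq_zero_of_dim_eq_zero hdim _ _ _
    have := hAne.to_subtype
    have := hBne.to_subtype
    simp [hf, hr]
  · push Not at hdim
    have : NeZero N := ⟨hdim.1⟩
    have : NeZero M := ⟨hdim.2⟩
    have hABpos : ∀ A ∈ 𝒜, ∀ B ∈ 𝒝, ∀ i j, 0 < (A * B) i j := fun A hA B hB =>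
      mul_entry_pos (hApos A hA) (hBpos B hB)
    have hAB0 : ∀ A ∈ 𝒜, ∀ B ∈ 𝒝, ∀ i j, 0 ≤ (A * B) i j := fun A hA B hB i j =>
      (hABpos A hA B hB i j).le
    obtain ⟨v, hv, heig⟩ := exists_pos_eigenvector (hABpos Atil hAtil Btil hBtil)
    have hr0 : 0 ≤ specRad (Atil * Btil) := specRad_nonneg _
    have hw : ∀ j, 0 < Btil.mulVec v j := mulVec_pos_of_pos (hBpos Btil hBtil) hv
    have hAw : Atil.mulVec (Btil.mulVec v) = specRad (Atil * Btil) • v := by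
      rw [Matrix.mulVec_mulVec, heig]
    have hAmax : ∀ A ∈ 𝒜, ∀ i,
        A.mulVec (Btil.mulVec v) i ≤ Atil.mulVec (Btil.mulVec v) i := by
      refine (hAH Atil hAtil _ hw).2.resolve_right ?_
      rintro ⟨Abar, hAbar, hle, hne⟩
      rw [hAw, Matrix.mulVec_mulVec] at hle hne
      exact absurd (hsaddle Abar hAbar Btil hBtil).1 (not_le.2
        (lt_specRad_of_le_mulVec_of_ne (hABpos Abar hAbar Btil hBtil) (fun i => (hv i).le)
          hr0 hle hne.symm))
    have hBmin : ∀ B ∈ 𝒝, ∀ i, Btil.mulVec v i ≤ B.mulVec v i := by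
      refine (hBH Btil hBtil v hv).1.resolve_right ?_
      rintro ⟨Bbar, hBbar, hle, hne⟩
      refine absurd (hsaddle Atil hAtil Bbar hBbar).2 (not_le.2
        (specRad_lt_of_mulVec_lt (hAB0 Atil hAtil Bbar hBbar) hv fun i => ?_))
      have := mulVec_strictMono_of_pos (hApos Atil hAtil) hle hne i
      rwa [hAw, Matrix.mulVec_mulVec] at this
    refine iSup_iInf_eq_of_saddle
      (f := fun (A : Fin n → 𝒜) (B : Fin n → 𝒝) =>
        specRad (prodABFin (fun i => (A i : Matrix (Fin N) (Fin M) ℝ))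
          fun i => (B i : Matrix (Fin M) (Fin N) ℝ)))
      (fun _ _ => specRad_nonneg _) (fun B => ?_)
      (fun _ => ⟨Atil, hAtil⟩) (fun _ => ⟨Btil, hBtil⟩) (fun B => ?_) (fun A => ?_)
    · obtain ⟨K, hK0, hK⟩ := exists_entry_bound hAcomp
      obtain ⟨L, hL0, hL⟩ := exists_entry_bound hBcomp
      refine ⟨(M * K * (N * L)) ^ n, ?_⟩
      rintro _ ⟨A, rfl⟩
      refine specRad_prodABFin_le (fun k => hAB0 _ (A k).2 _ (B k).2) (v := fun _ => 1)
        (fun _ => one_pos) (by positivity) fun k i => ?_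
      have hBone (j : Fin M) : (B k : Matrix (Fin M) (Fin N) ℝ).mulVec (fun _ => 1) j ≤ N * L := by
        simpa [Matrix.mulVec, dotProduct] using
          Finset.sum_le_card_nsmul Finset.univ _ L fun l _ => hL _ (B k).2 j l
      rw [← Matrix.mulVec_mulVec]
      refine (mulVec_mono_of_nonneg (hA0 _ (A k).2) hBone i).trans ?_
      rw [mul_one, mul_assoc]
      simpa [Matrix.mulVec, dotProduct] using
        Finset.sum_le_card_nsmul Finset.univ
          (fun j => (A k : Matrix (Fin N) (Fin M) ℝ) i j * (N * L)) (K * (N * L))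
          fun j _ => mul_le_mul_of_nonneg_right (hK _ (A k).2 i j) (by positivity)
    · refine le_specRad_prodABFin (fun k => hAB0 _ hAtil _ (B k).2) hv hr0 fun k i => ?_
      rw [← Matrix.mulVec_mulVec]
      exact (congrFun hAw i).ge.trans
        (mulVec_mono_of_nonneg (hA0 _ hAtil) (hBmin _ (B k).2) i)
    · refine specRad_prodABFin_le (fun k => hAB0 _ (A k).2 _ hBtil) hv hr0 fun k i => ?_
      rw [← Matrix.mulVec_mulVec]
      exact (hAmax _ (A k).2 i).trans (congrFun hAw i).le
end

section
/- Suppose that for every sequence (A_n)_{n≥1} with A_n ∈ 𝒜 there exists a sequence (B_n)_{n≥1} with B_n ∈ 𝒝 such that ‖A_n B_n ⋯ A_1 B_1‖ → 0 as n → ∞ (path-dependent stabilizability). Then there exist constants C > 0 and λ ∈ (0,1) such that for every sequence (A_n)_{n≥1} with A_n ∈ 𝒜 there exists a sequence (B_n)_{n≥1} with B_n ∈ 𝒝 satisfying ‖A_n B_n ⋯ A_1 B_1‖ ≤ C·λ^n for all n ≥ 1. -/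
open Filter

/-- The product `A_n B_n ⋯ A_1 B_1` of the first `n` pairs of factors of two
sequences of matrices (the pair with index `i`, `1 ≤ i ≤ n`, being `A (i-1) * B (i-1)`). -/
def prodAB {N M : ℕ} (A : ℕ → Matrix (Fin N) (Fin M) ℝ)
    (B : ℕ → Matrix (Fin M) (Fin N) ℝ) : ℕ → Matrix (Fin N) (Fin N) ℝ
  | 0 => 1
  | n + 1 => (A n * B n) * prodAB A B n

/-- The first `n` factors of both sequences determine `prodAB A B n`. -/
theorem prodAB_congr {N M : ℕ} {A A' : ℕ → Matrix (Fin N) (Fin M) ℝ}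
    {B B' : ℕ → Matrix (Fin M) (Fin N) ℝ} {n : ℕ} (hA : ∀ k < n, A k = A' k)
    (hB : ∀ k < n, B k = B' k) : prodAB A B n = prodAB A' B' n := by
  induction n with
  | zero => rfl
  | succ n ih =>
    rw [prodAB, prodAB, hA n n.lt_succ_self, hB n n.lt_succ_self,
      ih (fun k hk => hA k (hk.trans n.lt_succ_self)) (fun k hk => hB k (hk.trans n.lt_succ_self))]

/-- By compactness of the space of sequences in a finite set, a property of sequences that holds
at some time, and at each time depends only on finitely many terms, holds within a uniform time. -/
theorem exists_uniform_time {α : Type*} (s : Finset α) (p : ℕ → (ℕ → α) → Prop)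
    (hp : ∀ n a a', (∀ k < n, a k = a' k) → p n a → p n a')
    (h : ∀ a : ℕ → α, (∀ n, a n ∈ s) → ∃ n, p n a) :
    ∃ K, ∀ a : ℕ → α, (∀ n, a n ∈ s) → ∃ n ≤ K, p n a := by
  let _ : TopologicalSpace s := ⊥
  have : DiscreteTopology s := ⟨rfl⟩
  let U : ℕ → Set (ℕ → s) := fun n => {a | p n fun k => (a k : α)}
  have hU : ∀ n, IsOpen (U n) := by
    intro n
    rw [isOpen_iff_mem_nhds]
    intro a ha
    have hev : ∀ᶠ a' in nhds a, ∀ k ∈ Finset.range n, a' k = a k := by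
      rw [Filter.eventually_all_finset]
      intro k _
      have := (continuous_apply (A := fun _ : ℕ => s) k).tendsto a
      rw [nhds_discrete s, tendsto_pure] at this
      exact this
    filter_upwards [hev] with a' ha'
    exact hp n _ _ (fun k hk => by rw [ha' k (Finset.mem_range.2 hk)]) ha
  obtain ⟨t, ht⟩ := isCompact_univ.elim_finite_subcover U hU (by
    intro a _
    obtain ⟨n, hn⟩ := h (fun k => a k) fun k => (a k).2
    exact Set.mem_iUnion.2 ⟨n, hn⟩)
  refine ⟨t.sup id, fun a ha => ?_⟩
  obtain ⟨n, hn, hna⟩ := Set.mem_iUnion₂.1 (ht (Set.mem_univ fun k => (⟨a k, ha k⟩ : s)))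
  exact ⟨n, Finset.le_sup (f := id) hn, hna⟩

/-- Products of at most `K` pairs of factors from finite sets are uniformly bounded. -/
theorem exists_bound_prodAB {N M : ℕ} (𝒜 : Finset (Matrix (Fin N) (Fin M) ℝ))
    (𝒝 : Finset (Matrix (Fin M) (Fin N) ℝ)) (ν : Matrix (Fin N) (Fin N) ℝ → ℝ)
    (hν_nonneg : ∀ X, 0 ≤ ν X) (hν_mul : ∀ X Y, ν (X * Y) ≤ ν X * ν Y) (K : ℕ) :
    ∃ D : ℝ, 0 ≤ D ∧ ∀ A : ℕ → Matrix (Fin N) (Fin M) ℝ, (∀ n, A n ∈ 𝒜) →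
      ∀ B : ℕ → Matrix (Fin M) (Fin N) ℝ, (∀ n, B n ∈ 𝒝) →
        ∀ i ≤ K, ν (prodAB A B i) ≤ D := by
  induction K with
  | zero =>
    refine ⟨ν 1, hν_nonneg 1, fun A _ B _ i hi => ?_⟩
    rw [Nat.le_zero.1 hi, prodAB]
  | succ K ih =>
    obtain ⟨D, hD0, hD⟩ := ih
    obtain ⟨L, hL⟩ := ((𝒜 ×ˢ 𝒝).image fun x => ν (x.1 * x.2)).exists_le
    refine ⟨max D (L * D), hD0.trans (le_max_left _ _), fun A hA B hB i hi => ?_⟩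
    rcases Nat.le_succ_iff.1 hi with hi | rfl
    · exact (hD A hA B hB i hi).trans (le_max_left _ _)
    · have hAB : ν (A K * B K) ≤ L := hL _ (Finset.mem_image.2
        ⟨(A K, B K), Finset.mem_product.2 ⟨hA K, hB K⟩, rfl⟩)
      refine le_trans ?_ (le_max_right _ _)
      exact (hν_mul _ _).trans (mul_le_mul hAB (hD A hA B hB K le_rfl) (hν_nonneg _)
        ((hν_nonneg _).trans hAB))


/-- Let `𝒜`, `𝒝` be nonempty finite sets of `N×M` and `M×N`
real matrices and `ν` the operator norm on `N×N` matrices induced by a vector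
norm on `ℝ^N`.  If for every sequence `(A_n) ⊆ 𝒜` there exists a sequence
`(B_n) ⊆ 𝒝` with `ν (A_n B_n ⋯ A_1 B_1) → 0`, then there exist constants
`C > 0` and `λ ∈ (0,1)` such that for every sequence `(A_n) ⊆ 𝒜` there exists a
sequence `(B_n) ⊆ 𝒝` with `ν (A_n B_n ⋯ A_1 B_1) ≤ C * λ^n` for all `n ≥ 1`. -/
theorem pathDependent_exponential_decay {N M : ℕ}
    (𝒜 : Finset (Matrix (Fin N) (Fin M) ℝ))
    (𝒝 : Finset (Matrix (Fin M) (Fin N) ℝ)) (hA : 𝒜.Nonempty) (hB : 𝒝.Nonempty)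
    (ν : Matrix (Fin N) (Fin N) ℝ → ℝ)
    (hν_zero : ∀ X : Matrix (Fin N) (Fin N) ℝ, ν X = 0 ↔ X = 0)
    (hν_smul : ∀ (c : ℝ) (X : Matrix (Fin N) (Fin N) ℝ), ν (c • X) = |c| * ν X)
    (hν_add : ∀ X Y : Matrix (Fin N) (Fin N) ℝ, ν (X + Y) ≤ ν X + ν Y)
    (hν_mul : ∀ X Y : Matrix (Fin N) (Fin N) ℝ, ν (X * Y) ≤ ν X * ν Y)
    (hstab : ∀ A : ℕ → Matrix (Fin N) (Fin M) ℝ, (∀ n, A n ∈ 𝒜) →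
      ∃ B : ℕ → Matrix (Fin M) (Fin N) ℝ, (∀ n, B n ∈ 𝒝) ∧
        Tendsto (fun n => ν (prodAB A B n)) atTop (nhds 0)) :
    ∃ C : ℝ, 0 < C ∧ ∃ l : ℝ, l ∈ Set.Ioo (0 : ℝ) 1 ∧
      ∀ A : ℕ → Matrix (Fin N) (Fin M) ℝ, (∀ n, A n ∈ 𝒜) →
        ∃ B : ℕ → Matrix (Fin M) (Fin N) ℝ, (∀ n, B n ∈ 𝒝) ∧
          ∀ n : ℕ, 1 ≤ n → ν (prodAB A B n) ≤ C * l ^ n := by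
  have hν_nonneg : ∀ X, 0 ≤ ν X := by
    intro X
    have h0 : ν 0 = 0 := (hν_zero 0).2 rfl
    have h1 := hν_add X ((-1 : ℝ) • X)
    have h2 : X + (-1 : ℝ) • X = 0 := by simp
    rw [h2, h0, hν_smul] at h1
    norm_num at h1
    linarith
  have hcontract : ∀ A : ℕ → Matrix (Fin N) (Fin M) ℝ, (∀ n, A n ∈ 𝒜) →
      ∃ n, ∃ B : ℕ → Matrix (Fin M) (Fin N) ℝ, (∀ n, B n ∈ 𝒝) ∧ 1 ≤ n ∧
        ν (prodAB A B n) ≤ 1 / 2 := by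
    intro A hA
    obtain ⟨B, hB, hlim⟩ := hstab A hA
    obtain ⟨n, hn, hn1⟩ :=
      ((hlim.eventually_le_const (by norm_num : (0 : ℝ) < 1 / 2)).and (eventually_ge_atTop 1)).exists
    exact ⟨n, B, hB, hn1, hn⟩
  obtain ⟨K, hK⟩ := exists_uniform_time 𝒜
    (fun n A => ∃ B : ℕ → Matrix (Fin M) (Fin N) ℝ, (∀ n, B n ∈ 𝒝) ∧ 1 ≤ n ∧
      ν (prodAB A B n) ≤ 1 / 2)
    (fun n A A' hAA' ⟨B, hB, hn, hAB⟩ =>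
      ⟨B, hB, hn, by rwa [← prodAB_congr hAA' fun _ _ => rfl]⟩) hcontract
  obtain ⟨l, hl0, hl1, hlK⟩ : ∃ l : ℝ, 0 < l ∧ l < 1 ∧ 1 / 2 ≤ l ^ K := by
    have hev : ∀ᶠ l : ℝ in nhdsWithin 1 (Set.Iio 1), 1 / 2 ≤ l ^ K := by
      have hc : Tendsto (fun l : ℝ => l ^ K) (nhds 1) (nhds 1) := by
        simpa using (continuous_pow (M := ℝ) K).tendsto 1
      exact (hc.mono_left nhdsWithin_le_nhds).eventually_const_le (by norm_num)
    obtain ⟨l, hl, hl'⟩ :=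
      (hev.and (Ioo_mem_nhdsLT (zero_lt_one : (0 : ℝ) < 1))).exists
    exact ⟨l, hl'.1, hl'.2, hl⟩
  obtain ⟨D, hD0, hD⟩ := exists_bound_prodAB 𝒜 𝒝 ν hν_nonneg hν_mul K
  choose τ hτK β hβ hτ1 hβτ using fun a : {a : ℕ → Matrix (Fin N) (Fin M) ℝ // ∀ n, a n ∈ 𝒜} =>
    hK a.1 a.2
  refine ⟨D * (ν 1 / l ^ K) + 1, add_pos_of_nonneg_of_pos
    (mul_nonneg hD0 (div_nonneg (hν_nonneg 1) (pow_pos hl0 K).le)) one_pos, l, ⟨hl0, hl1⟩, ?_⟩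
  intro A hA
  -- A state is the tail of `A` from the start of the current block, and the position in the block.
  let next : {a : ℕ → Matrix (Fin N) (Fin M) ℝ // ∀ n, a n ∈ 𝒜} × ℕ →
      {a : ℕ → Matrix (Fin N) (Fin M) ℝ // ∀ n, a n ∈ 𝒜} × ℕ := fun x =>
    if x.2 + 1 = τ x.1 then (⟨fun k => x.1.1 (k + τ x.1), fun k => x.1.2 _⟩, 0)
    else (x.1, x.2 + 1)
  let S : ℕ → {a : ℕ → Matrix (Fin N) (Fin M) ℝ // ∀ n, a n ∈ 𝒜} × ℕ :=
    fun t => next^[t] (⟨A, hA⟩, 0)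
  have hS : ∀ t, S (t + 1) = next (S t) := fun t => Function.iterate_succ_apply' next t _
  let B : ℕ → Matrix (Fin M) (Fin N) ℝ := fun t => β (S t).1 (S t).2
  have hinv : ∀ t, (∀ k, (S t).1.1 (k + (S t).2) = A (k + t)) ∧ (S t).2 < τ (S t).1 ∧
      ∃ R, prodAB A B t = prodAB (S t).1.1 (β (S t).1) (S t).2 * R ∧
        ν R * l ^ (S t).2 ≤ ν 1 * l ^ t := by
    intro t
    induction t with
    | zero => exact ⟨fun k => rfl, hτ1 _, 1, by simp [S, prodAB], by simp [S]⟩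
    | succ t ih =>
      obtain ⟨htail, hlt, R, hR, hνR⟩ := ih
      have hstep : prodAB A B (t + 1) =
          prodAB (S t).1.1 (β (S t).1) ((S t).2 + 1) * R := by
        have h0 := htail 0
        rw [zero_add, zero_add] at h0
        rw [prodAB, prodAB, hR, h0, Matrix.mul_assoc (A t * _)]
      rw [hS]
      by_cases hend : (S t).2 + 1 = τ (S t).1
      · simp only [next, if_pos hend]
        refine ⟨fun k => ?_, hτ1 _, _, hstep.trans (Matrix.one_mul _).symm, ?_⟩
        · rw [← hend, add_zero, show k + ((S t).2 + 1) = k + 1 + (S t).2 by ring, htail]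
          congr 1
          ring
        · have hhalf : ν (prodAB (S t).1.1 (β (S t).1) ((S t).2 + 1)) ≤ l ^ ((S t).2 + 1) := by
            rw [hend]
            exact ((hβτ _).trans hlK).trans (pow_le_pow_of_le_one hl0.le hl1.le (hτK _))
          calc ν (prodAB (S t).1.1 (β (S t).1) ((S t).2 + 1) * R) * l ^ 0
              ≤ l ^ ((S t).2 + 1) * ν R := by
                rw [pow_zero, mul_one]
                exact (hν_mul _ _).trans (mul_le_mul_of_nonneg_right hhalf (hν_nonneg R))
            _ = (ν R * l ^ (S t).2) * l := by ring
            _ ≤ (ν 1 * l ^ t) * l := mul_le_mul_of_nonneg_right hνR hl0.le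
            _ = ν 1 * l ^ (t + 1) := by ring
      · simp only [next, if_neg hend]
        refine ⟨fun k => ?_, by omega, R, hstep, ?_⟩
        · rw [show k + ((S t).2 + 1) = k + 1 + (S t).2 by ring, htail]
          congr 1
          ring
        · rw [pow_succ, pow_succ, ← mul_assoc, ← mul_assoc]
          exact mul_le_mul_of_nonneg_right hνR hl0.le
  refine ⟨B, fun t => hβ _ _, fun t _ => ?_⟩
  obtain ⟨-, hlt, R, hR, hνR⟩ := hinv t
  have hSK : (S t).2 ≤ K := hlt.le.trans (hτK _)
  have hRt : ν R ≤ ν 1 / l ^ K * l ^ t := by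
    rw [div_mul_eq_mul_div, le_div_iff₀ (pow_pos hl0 K)]
    exact (mul_le_mul_of_nonneg_left (pow_le_pow_of_le_one hl0.le hl1.le hSK)
      (hν_nonneg R)).trans hνR
  calc ν (prodAB A B t) ≤ ν (prodAB (S t).1.1 (β (S t).1) (S t).2) * ν R := hR ▸ hν_mul _ _
    _ ≤ D * (ν 1 / l ^ K * l ^ t) :=
      mul_le_mul (hD _ (S t).1.2 _ (hβ _) _ hSK) hRt (hν_nonneg R) hD0
    _ ≤ (D * (ν 1 / l ^ K) + 1) * l ^ t := by
      rw [add_mul, ← mul_assoc, one_mul]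
      exact le_add_of_nonneg_right (pow_pos hl0 t).le
end

section
/- Let (B̄_n)_{n≥1} be a sequence with B̄_n ∈ 𝒝 that is periodic (there exists k ≥ 1 with B̄_{n+k} = B̄_n for all n) and suppose that for every sequence (A_n)_{n≥1} with A_n ∈ 𝒜 one has ‖A_n B̄_n ⋯ A_1 B̄_1‖ → 0 as n → ∞. Then there exist constants C > 0 and λ ∈ (0,1) such that ‖A_n B̄_n ⋯ A_1 B̄_1‖ ≤ C·λ^n for every sequence (A_n)_{n≥1} with A_n ∈ 𝒜 and all n ≥ 1. -/
open Filter

lemma prodAB_add {N M : ℕ} (A : ℕ → Matrix (Fin N) (Fin M) ℝ)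
    (B : ℕ → Matrix (Fin M) (Fin N) ℝ) (p n : ℕ) :
    prodAB A B (n + p) =
      prodAB (fun i => A (i + p)) (fun i => B (i + p)) n * prodAB A B p := by
  induction n with
  | zero => simp [prodAB]
  | succ n ih => rw [Nat.add_right_comm, prodAB, ih, prodAB, ← Matrix.mul_assoc]

/-- For left factors drawn from a discrete space, each partial product depends on only
finitely many of them. -/
lemma isLocallyConstant_prodAB {N M : ℕ} {ι : Type*} [TopologicalSpace ι] [DiscreteTopology ι]
    (f : ι → Matrix (Fin N) (Fin M) ℝ) (B : ℕ → Matrix (Fin M) (Fin N) ℝ) (n : ℕ) :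
    IsLocallyConstant (fun a : ℕ → ι => prodAB (fun i => f (a i)) B n) := by
  induction n with
  | zero => exact IsLocallyConstant.const 1
  | succ n ih =>
    have h : IsLocallyConstant (fun a : ℕ → ι => a n) :=
      (IsLocallyConstant.iff_continuous _).2 (continuous_apply n)
    exact (h.comp (fun x => f x * B n)).comp₂ ih (fun X Y => X * Y)

/-- A countable family of open sets covering a compact space has a bounded subfamily
that already covers it. -/
lemma exists_bound_of_open_cover {X : Type*} [TopologicalSpace X] [CompactSpace X]
    (U : ℕ → Set X) (hU : ∀ m, IsOpen (U m)) (hcov : ∀ x, ∃ m, x ∈ U m) :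
    ∃ L, ∀ x, ∃ m ≤ L, x ∈ U m := by
  obtain ⟨t, ht⟩ := isCompact_univ.elim_finite_subcover U hU
    (fun x _ => Set.mem_iUnion.2 (hcov x))
  refine ⟨t.sup id, fun x => ?_⟩
  obtain ⟨m, hm, hx⟩ := Set.mem_iUnion₂.1 (ht (Set.mem_univ x))
  exact ⟨m, Finset.le_sup (f := id) hm, hx⟩

lemma exists_pow_eq_half {p : ℕ} (hp : p ≠ 0) :
    ∃ l : ℝ, l ∈ Set.Ioo (0 : ℝ) 1 ∧ l ^ p = 1 / 2 := by
  have h0 : (0 : ℝ) < (1 / 2 : ℝ) ^ ((p : ℝ)⁻¹) := by positivity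
  refine ⟨(1 / 2 : ℝ) ^ ((p : ℝ)⁻¹), ⟨h0, ?_⟩, Real.rpow_inv_natCast_pow (by norm_num) hp⟩
  exact Real.rpow_lt_one (by norm_num) (by norm_num) (by positivity)

/-- Let `𝒜`, `𝒝` be nonempty finite sets of `N×M` and `M×N`
real matrices and `ν` the operator norm on `N×N` matrices induced by a vector
norm on `ℝ^N`.  Let `(B̄_n) ⊆ 𝒝` be a periodic sequence (with some period
`k ≥ 1`) such that `ν (A_n B̄_n ⋯ A_1 B̄_1) → 0` for every sequence
`(A_n) ⊆ 𝒜`.  Then there exist constants `C > 0` and `λ ∈ (0,1)` such that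
`ν (A_n B̄_n ⋯ A_1 B̄_1) ≤ C * λ^n` for every sequence `(A_n) ⊆ 𝒜` and all
`n ≥ 1`. -/
theorem periodic_exponential_decay {N M : ℕ}
    (𝒜 : Finset (Matrix (Fin N) (Fin M) ℝ))
    (𝒝 : Finset (Matrix (Fin M) (Fin N) ℝ)) (hA : 𝒜.Nonempty) (hB : 𝒝.Nonempty)
    (ν : Matrix (Fin N) (Fin N) ℝ → ℝ)
    (hν_zero : ∀ X : Matrix (Fin N) (Fin N) ℝ, ν X = 0 ↔ X = 0)
    (hν_smul : ∀ (c : ℝ) (X : Matrix (Fin N) (Fin N) ℝ), ν (c • X) = |c| * ν X)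
    (hν_add : ∀ X Y : Matrix (Fin N) (Fin N) ℝ, ν (X + Y) ≤ ν X + ν Y)
    (hν_mul : ∀ X Y : Matrix (Fin N) (Fin N) ℝ, ν (X * Y) ≤ ν X * ν Y)
    (Bbar : ℕ → Matrix (Fin M) (Fin N) ℝ) (hBmem : ∀ n, Bbar n ∈ 𝒝)
    (k : ℕ) (hk : 1 ≤ k) (hper : ∀ n, Bbar (n + k) = Bbar n)
    (hstab : ∀ A : ℕ → Matrix (Fin N) (Fin M) ℝ, (∀ n, A n ∈ 𝒜) →
      Tendsto (fun n => ν (prodAB A Bbar n)) atTop (nhds 0)) :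
    ∃ C : ℝ, 0 < C ∧ ∃ l : ℝ, l ∈ Set.Ioo (0 : ℝ) 1 ∧
      ∀ A : ℕ → Matrix (Fin N) (Fin M) ℝ, (∀ n, A n ∈ 𝒜) →
        ∀ n : ℕ, 1 ≤ n → ν (prodAB A Bbar n) ≤ C * l ^ n := by
  have hν_nonneg : ∀ X, 0 ≤ ν X := fun X => by
    have h := hν_add X ((-1 : ℝ) • X)
    rw [hν_smul, neg_one_smul, add_neg_cancel, (hν_zero 0).2 rfl] at h
    norm_num at h
    linarith
  have hper' : ∀ m n, Bbar (n + m * k) = Bbar n := fun m => by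
    induction m with
    | zero => simp
    | succ m ih => intro n; rw [Nat.succ_mul, ← add_assoc, hper, ih]
  obtain ⟨L, hL⟩ : ∃ L, ∀ A : ℕ → Matrix (Fin N) (Fin M) ℝ, (∀ n, A n ∈ 𝒜) →
      ∃ m ≤ L, ν (prodAB A Bbar ((m + 1) * k)) < 1 / 2 := by
    let _ : TopologicalSpace 𝒜 := ⊥
    have : DiscreteTopology 𝒜 := ⟨rfl⟩
    obtain ⟨L, hL⟩ := exists_bound_of_open_cover
      (fun m => {a : ℕ → 𝒜 | ν (prodAB (fun i => (a i).1) Bbar ((m + 1) * k)) < 1 / 2})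
      (fun m => (isLocallyConstant_prodAB (fun a : 𝒜 => a.1) Bbar ((m + 1) * k))
        {X | ν X < 1 / 2})
      (fun a => by
        have h := (hstab (fun i => (a i).1) (fun i => (a i).2)).eventually
          (gt_mem_nhds (by norm_num : (0 : ℝ) < 1 / 2))
        obtain ⟨n, hn⟩ := eventually_atTop.1 h
        exact ⟨n, hn _ (by nlinarith)⟩)
    exact ⟨L, fun A hA => hL (fun n => ⟨A n, hA n⟩)⟩
  obtain ⟨c, hc1, hc⟩ : ∃ c : ℝ, 1 ≤ c ∧ ∀ X ∈ 𝒜, ∀ Y ∈ 𝒝, ν (X * Y) ≤ c := by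
    obtain ⟨c, hc⟩ := ((𝒜 ×ˢ 𝒝).image (fun p => ν (p.1 * p.2))).bddAbove
    refine ⟨max 1 c, le_max_left _ _, fun X hX Y hY => le_max_of_le_right (hc ?_)⟩
    exact Finset.mem_coe.2 (Finset.mem_image.2 ⟨(X, Y), Finset.mk_mem_product hX hY, rfl⟩)
  have hgrowth : ∀ A : ℕ → Matrix (Fin N) (Fin M) ℝ, (∀ n, A n ∈ 𝒜) →
      ∀ n, ν (prodAB A Bbar n) ≤ (1 + ν 1) * c ^ n := fun A hA n => by
    induction n with
    | zero => simp [prodAB]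
    | succ n ih =>
      calc ν (prodAB A Bbar (n + 1)) ≤ ν (A n * Bbar n) * ν (prodAB A Bbar n) := hν_mul _ _
        _ ≤ c * ((1 + ν 1) * c ^ n) :=
          mul_le_mul (hc _ (hA n) _ (hBmem n)) ih (hν_nonneg _) (by linarith)
        _ = (1 + ν 1) * c ^ (n + 1) := by ring
  have hp : (L + 1) * k ≠ 0 := by positivity
  obtain ⟨l, hl, hlp⟩ := exists_pow_eq_half hp
  have hhalf : ∀ n ≤ (L + 1) * k, 1 / 2 ≤ l ^ n := fun n hn =>
    hlp ▸ pow_le_pow_of_le_one hl.1.le hl.2.le hn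
  set K : ℝ := (1 + ν 1) * c ^ ((L + 1) * k)
  have hK : 0 < K := by have := hν_nonneg 1; positivity
  refine ⟨2 * K, by positivity, l, hl, fun A hA n _ => ?_⟩
  induction n using Nat.strong_induction_on generalizing A with
  | _ n ih =>
    rcases le_or_gt n ((L + 1) * k) with hn | hn
    · calc ν (prodAB A Bbar n) ≤ (1 + ν 1) * c ^ n := hgrowth A hA n
        _ ≤ K := mul_le_mul_of_nonneg_left (pow_le_pow_right₀ hc1 hn)
          (by linarith [hν_nonneg 1])
        _ ≤ 2 * K * l ^ n := by nlinarith [hhalf n hn]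
    · obtain ⟨m, hm, hlt⟩ := hL A hA
      have hmk : (m + 1) * k ≤ (L + 1) * k := by gcongr
      have hpos : 0 < (m + 1) * k := by positivity
      obtain ⟨q, rfl⟩ := Nat.exists_eq_add_of_le' (hmk.trans hn.le)
      rw [prodAB_add]
      simp only [hper']
      calc _ ≤ _ := hν_mul _ _
        _ ≤ (2 * K * l ^ q) * l ^ ((m + 1) * k) :=
          mul_le_mul (ih q (by lia) _ (fun i => hA _) (by lia))
            (hlt.le.trans (hhalf _ hmk)) (hν_nonneg _)
            (by have := hl.1; positivity)
        _ = _ := by rw [pow_add, mul_assoc]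
end
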